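/- Let n ≥ 7 be an integer, let b ∈ {1, …, n−6} be fixed, and for p = 1, …, n−b−4 let T_p = T(p, b, n−p−b−3) be the caterpillar of order n. Then for every p ∈ {1, …, n−b−4}, RE(T_1) ≤ RE(T_p) ≤ RE(T_{⌊(n−b−3)/2⌋}). -/

import Mathlib

open Polynomial

open scoped Classical in
/-- The Randić matrix of a simple graph `G`: the `(u,v)` entry is `1/√(d_u d_v)` when `uv` is
an edge and `0` otherwise, where `d_v` is the degree of the vertex `v`. -/
noncomputable def randicMatrix {V : Type*} (G : SimpleGraph V) : Matrix V V ℝ :=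
  Matrix.of fun u v =>
    if G.Adj u v then
      1 / Real.sqrt (((G.neighborSet u).ncard : ℝ) * ((G.neighborSet v).ncard : ℝ))
    else 0

lemma randicMatrix_isHermitian {V : Type*} (G : SimpleGraph V) :
    (randicMatrix G).IsHermitian := by
  ext u v
  by_cases h : G.Adj u v
  · simp [randicMatrix, Matrix.conjTranspose_apply, h, h.symm, mul_comm]
  · have h' : ¬ G.Adj v u := fun hc => h hc.symm
    simp [randicMatrix, Matrix.conjTranspose_apply, h, h']

/-- The Randić energy of a graph: the sum of the absolute values of the eigenvalues of its
Randić matrix. -/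
noncomputable def randicEnergy {V : Type*} [Fintype V] [DecidableEq V] (G : SimpleGraph V) : ℝ :=
  ∑ i, |(randicMatrix_isHermitian G).eigenvalues i|

/-- The caterpillar `T(p 0, …, p (r-1))`: a path `v_0 v_1 ⋯ v_{r-1}` (the `Sum.inl` vertices)
together with, for each `i`, `p i` pendant vertices attached to `v_i` (the `Sum.inr` vertices). -/
def caterpillar (r : ℕ) (p : Fin r → ℕ) :
    SimpleGraph ((Fin r) ⊕ (Σ i : Fin r, Fin (p i))) :=
  SimpleGraph.fromRel (fun u v =>
    (∃ i j : Fin r, u = Sum.inl i ∧ v = Sum.inl j ∧ (i : ℕ) + 1 = (j : ℕ)) ∨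
    (∃ (i : Fin r) (k : Fin (p i)), u = Sum.inl i ∧ v = Sum.inr ⟨i, k⟩))

lemma caterpillar_adj_inl_inl {r : ℕ} (p : Fin r → ℕ) (i j : Fin r) :
    (caterpillar r p).Adj (Sum.inl i) (Sum.inl j) ↔
      (i : ℕ) + 1 = j ∨ (j : ℕ) + 1 = i := by
  simp only [caterpillar, SimpleGraph.fromRel_adj]
  constructor
  · rintro ⟨-, (⟨i', j', hi, hj, h⟩ | ⟨_, _, _, h⟩) | (⟨i', j', hi, hj, h⟩ | ⟨_, _, _, h⟩)⟩ <;>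
      simp_all
  · intro h
    refine ⟨fun hij => ?_, ?_⟩
    · cases hij
      omega
    · rcases h with h | h
      · exact Or.inl (Or.inl ⟨i, j, rfl, rfl, h⟩)
      · exact Or.inr (Or.inl ⟨j, i, rfl, rfl, h⟩)

lemma caterpillar_adj_inl_inr {r : ℕ} (p : Fin r → ℕ) (i : Fin r) (x : Σ i : Fin r, Fin (p i)) :
    (caterpillar r p).Adj (Sum.inl i) (Sum.inr x) ↔ i = x.1 := by
  obtain ⟨j, k⟩ := x
  simp only [caterpillar, SimpleGraph.fromRel_adj]
  constructor
  · rintro ⟨-, (⟨_, _, _, h, _⟩ | ⟨i', k', hi, hk⟩) | (⟨_, _, h, _⟩ | ⟨_, _, h, _⟩)⟩ <;>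
      simp_all
  · rintro rfl
    exact ⟨by simp, Or.inl (Or.inr ⟨i, k, rfl, rfl⟩)⟩

lemma caterpillar_not_adj_inr_inr {r : ℕ} (p : Fin r → ℕ) (x y : Σ i : Fin r, Fin (p i)) :
    ¬ (caterpillar r p).Adj (Sum.inr x) (Sum.inr y) := by
  simp [caterpillar, SimpleGraph.fromRel_adj]

lemma ncard_neighborSet_inr {r : ℕ} (p : Fin r → ℕ) (x : Σ i : Fin r, Fin (p i)) :
    ((caterpillar r p).neighborSet (Sum.inr x)).ncard = 1 := by
  rw [Set.ncard_eq_one]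
  refine ⟨Sum.inl x.1, ?_⟩
  ext (i | y)
  · simp [SimpleGraph.adj_comm, caterpillar_adj_inl_inr]
  · simp [caterpillar_not_adj_inr_inr]

lemma ncard_neighborSet_inl {r : ℕ} (p : Fin r → ℕ) (i : Fin r) :
    ((caterpillar r p).neighborSet (Sum.inl i)).ncard =
      {j : Fin r | (i : ℕ) + 1 = j ∨ (j : ℕ) + 1 = i}.ncard + p i := by
  have h : (caterpillar r p).neighborSet (Sum.inl i) =
      Sum.inl '' {j : Fin r | (i : ℕ) + 1 = j ∨ (j : ℕ) + 1 = i} ∪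
        Sum.inr '' (Sigma.mk i '' (Set.univ : Set (Fin (p i)))) := by
    ext (j | ⟨j, k⟩)
    · simp [caterpillar_adj_inl_inl]
    · simp only [SimpleGraph.mem_neighborSet, caterpillar_adj_inl_inr]
      constructor
      · rintro rfl
        simp
      · simp only [Set.mem_union, Set.mem_image, reduceCtorEq, and_false, exists_false, false_or,
          Sum.inr.injEq]
        rintro ⟨_, ⟨_, _, rfl⟩, h⟩
        exact congrArg Sigma.fst h
  rw [h, Set.ncard_union_eq, Set.ncard_image_of_injective _ Sum.inl_injective,
    Set.ncard_image_of_injective _ Sum.inr_injective,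
    Set.ncard_image_of_injective _ sigma_mk_injective, Set.ncard_univ, Nat.card_fin]
  rw [Set.disjoint_left]
  rintro _ ⟨_, _, rfl⟩ ⟨_, _, h⟩
  cases h

lemma ncard_neighborSet_caterpillar_three (p : Fin 3 → ℕ) (i : Fin 3) :
    ((caterpillar 3 p).neighborSet (Sum.inl i)).ncard = p i + ![1, 2, 1] i := by
  rw [ncard_neighborSet_inl, add_comm, Set.ncard_eq_toFinset_card']
  congr 1
  fin_cases i <;> simp <;> decide

/-- The spine-to-pendant block of the Randić matrix of a caterpillar with spine degrees `d`. -/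
noncomputable def pendantBlock (p d : Fin 3 → ℕ) : Matrix (Fin 3) (Σ i : Fin 3, Fin (p i)) ℝ :=
  Matrix.of fun i x => if i = x.1 then 1 / √(d i : ℝ) else 0

/-- The Randić matrix of the spine of a caterpillar with spine degrees `d`. -/
noncomputable def spineBlock (d : Fin 3 → ℕ) : Matrix (Fin 3) (Fin 3) ℝ :=
  !![0, 1 / √((d 0 : ℝ) * d 1), 0;
     1 / √((d 0 : ℝ) * d 1), 0, 1 / √((d 1 : ℝ) * d 2);
     0, 1 / √((d 1 : ℝ) * d 2), 0]

lemma randicMatrix_caterpillar_three (p : Fin 3 → ℕ) :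
    randicMatrix (caterpillar 3 p) =
      Matrix.fromBlocks (spineBlock (p + ![1, 2, 1])) (pendantBlock p (p + ![1, 2, 1]))
        (pendantBlock p (p + ![1, 2, 1])).transpose 0 := by
  ext (i | x) (j | y)
  · simp only [randicMatrix, Matrix.of_apply, caterpillar_adj_inl_inl,
      ncard_neighborSet_caterpillar_three, Matrix.fromBlocks_apply₁₁]
    fin_cases i <;> fin_cases j <;> simp [spineBlock] <;> rw [mul_comm]
  · simp [randicMatrix, pendantBlock, caterpillar_adj_inl_inr,
      ncard_neighborSet_caterpillar_three, ncard_neighborSet_inr]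
  · simp only [randicMatrix, Matrix.of_apply, SimpleGraph.adj_comm _ (Sum.inr x),
      caterpillar_adj_inl_inr, ncard_neighborSet_caterpillar_three, ncard_neighborSet_inr]
    simp only [Matrix.fromBlocks_apply₂₁, Matrix.transpose_apply, pendantBlock, Matrix.of_apply]
    split_ifs with h
    · simp
    · rfl
  · simp [randicMatrix, caterpillar_not_adj_inr_inr]

lemma pendantBlock_mul_transpose (p d : Fin 3 → ℕ) :
    pendantBlock p d * (pendantBlock p d).transpose =
      Matrix.diagonal fun i => (p i : ℝ) / d i := by
  ext i j
  simp only [Matrix.mul_apply, Matrix.transpose_apply, pendantBlock, Matrix.of_apply,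
    Fintype.sum_sigma, Matrix.diagonal_apply]
  by_cases h : i = j
  · subst h
    rw [Finset.sum_eq_single i]
    · simp [div_eq_mul_inv, ← mul_inv]
    · intro k _ hk
      simp [hk.symm]
    · simp
  · rw [if_neg h]
    refine Finset.sum_eq_zero fun k _ => ?_
    by_cases hk : i = k
    · subst hk
      simp [Ne.symm h]
    · simp [hk]

lemma Matrix.det_fromBlocks_smul_one {m k : Type*} [Fintype m] [Fintype k] [DecidableEq m]
    [DecidableEq k] (A : Matrix m m ℝ) (B : Matrix m k ℝ) (C : Matrix k m ℝ) {t : ℝ}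
    (ht : t ≠ 0) :
    (Matrix.fromBlocks A B C (t • (1 : Matrix k k ℝ))).det =
      t ^ Fintype.card k * (A - t⁻¹ • (B * C)).det := by
  have h : (t • (1 : Matrix k k ℝ)) * (t⁻¹ • 1) = 1 := by
    simp [smul_smul, ht]
  let _ : Invertible (t • (1 : Matrix k k ℝ)) := ⟨t⁻¹ • 1, by simp [smul_smul, ht], h⟩
  have hi : ⅟(t • (1 : Matrix k k ℝ)) = t⁻¹ • 1 := invOf_eq_right_inv h
  rw [Matrix.det_fromBlocks₂₂, hi]
  simp

lemma eval_charpoly_caterpillar_three (p : Fin 3 → ℕ) {t : ℝ} (ht : t ≠ 0) :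
    t ^ 3 * (randicMatrix (caterpillar 3 p)).charpoly.eval t =
      t ^ (∑ i, p i) * ((t ^ 2 - 1) * (t ^ 4
        - (2 - 2 / ((p 1 : ℝ) + 2)
          - (1 / ((p 0 : ℝ) + 1) + 1 / ((p 2 : ℝ) + 1)) * (1 - 1 / ((p 1 : ℝ) + 2))) * t ^ 2
        + p 1 / ((p 1 : ℝ) + 2) * (p 0 / ((p 0 : ℝ) + 1)) * (p 2 / ((p 2 : ℝ) + 1)))) := by
  rw [Matrix.eval_charpoly, randicMatrix_caterpillar_three]
  have hblock (A : Matrix (Fin 3) (Fin 3) ℝ) (B : Matrix (Fin 3) (Σ i : Fin 3, Fin (p i)) ℝ) :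
      Matrix.scalar _ t - Matrix.fromBlocks A B B.transpose 0 =
        Matrix.fromBlocks (t • 1 - A) (-B) (-B.transpose) (t • 1) := by
    rw [Matrix.scalar_apply, ← Matrix.smul_one_eq_diagonal, ← Matrix.fromBlocks_one,
      Matrix.fromBlocks_smul, sub_eq_add_neg, Matrix.fromBlocks_neg, Matrix.fromBlocks_add]
    simp [sub_eq_add_neg]
  rw [hblock, Matrix.det_fromBlocks_smul_one _ _ _ ht, Matrix.neg_mul, Matrix.mul_neg, neg_neg,
    pendantBlock_mul_transpose, mul_left_comm, Fintype.card_sigma]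
  simp only [Fintype.card_fin]
  congr 1
  rw [Matrix.det_fin_three]
  simp only [spineBlock, Matrix.sub_apply, Matrix.smul_apply, Matrix.diagonal_apply,
    Matrix.one_apply]
  simp
  have h0 : (0 : ℝ) < (p 0 : ℝ) + 1 := by positivity
  have h1 : (0 : ℝ) < (p 1 : ℝ) + 2 := by positivity
  have h2 : (0 : ℝ) < (p 2 : ℝ) + 1 := by positivity
  generalize (p 0 : ℝ) = a at *
  generalize (p 1 : ℝ) = b at *
  generalize (p 2 : ℝ) = c at *
  have h01 : √((a + 1) * (b + 2)) ^ 2 = (a + 1) * (b + 2) := Real.sq_sqrt (mul_pos h0 h1).le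
  have h12 : √((b + 2) * (c + 1)) ^ 2 = (b + 2) * (c + 1) := Real.sq_sqrt (mul_pos h1 h2).le
  have := (Real.sqrt_pos.2 (mul_pos h0 h1)).ne'
  have := (Real.sqrt_pos.2 (mul_pos h1 h2)).ne'
  field_simp
  simp only [h01, h12]
  ring

lemma sum_abs_four_roots {S Q : ℝ} (hQ : 0 ≤ Q) :
    |(√(S + 2 * Q) + √(S - 2 * Q)) / 2| + |(√(S + 2 * Q) - √(S - 2 * Q)) / 2| +
      |-((√(S + 2 * Q) + √(S - 2 * Q)) / 2)| + |-((√(S + 2 * Q) - √(S - 2 * Q)) / 2)| =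
      2 * √(S + 2 * Q) := by
  have h : √(S - 2 * Q) ≤ √(S + 2 * Q) := Real.sqrt_le_sqrt (by linarith)
  have h' := Real.sqrt_nonneg (S - 2 * Q)
  rw [abs_neg, abs_neg, abs_of_nonneg (by linarith), abs_of_nonneg (by linarith)]
  ring

lemma four_roots_factorization {S Q : ℝ} (hQ : 0 ≤ Q) (hS : 2 * Q ≤ S) (t : ℝ) :
    (t - (√(S + 2 * Q) + √(S - 2 * Q)) / 2) * ((t - (√(S + 2 * Q) - √(S - 2 * Q)) / 2) *
      ((t - -((√(S + 2 * Q) + √(S - 2 * Q)) / 2)) *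
        (t - -((√(S + 2 * Q) - √(S - 2 * Q)) / 2)))) =
      t ^ 4 - S * t ^ 2 + Q ^ 2 := by
  have hw : √(S + 2 * Q) ^ 2 = S + 2 * Q := Real.sq_sqrt (by linarith)
  have hv : √(S - 2 * Q) ^ 2 = S - 2 * Q := Real.sq_sqrt (by linarith)
  generalize √(S + 2 * Q) = w at *
  generalize √(S - 2 * Q) = v at *
  obtain rfl : S = (w ^ 2 + v ^ 2) / 2 := by linarith
  obtain rfl : Q = (w ^ 2 - v ^ 2) / 4 := by linarith
  ring

lemma randicEnergy_eq_sum_roots {V : Type*} [Fintype V] [DecidableEq V] (G : SimpleGraph V) :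
    randicEnergy G = ((randicMatrix G).charpoly.roots.map fun x => |x|).sum := by
  rw [(randicMatrix_isHermitian G).roots_charpoly_eq_eigenvalues, Multiset.map_map]
  rfl

lemma randicEnergy_eq_of_eval_charpoly {V : Type*} [Fintype V] [DecidableEq V]
    (G : SimpleGraph V) {k m : ℕ} (hk : k ≠ 0) (hm : m ≠ 0) (s : Multiset ℝ)
    (h : ∀ t : ℝ, t ≠ 0 → t ^ k * (randicMatrix G).charpoly.eval t =
      t ^ m * (s.map fun x => t - x).prod) :
    randicEnergy G = (s.map fun x => |x|).sum := by
  have hpoly : X ^ k * (randicMatrix G).charpoly = X ^ m * (s.map fun x => X - C x).prod := by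
    refine Polynomial.funext fun t => ?_
    rcases eq_or_ne t 0 with rfl | ht
    · simp [hk, hm]
    · simpa [Polynomial.eval_multiset_prod, Multiset.map_map] using h t ht
  have hs : (s.map fun x => X - C x).prod ≠ 0 :=
    (Polynomial.monic_multiset_prod_of_monic _ _ fun x _ => Polynomial.monic_X_sub_C x).ne_zero
  have hroots := congrArg (fun f : ℝ[X] => (f.roots.map fun x => |x|).sum) hpoly
  rw [Polynomial.roots_mul (mul_ne_zero (pow_ne_zero _ X_ne_zero)
      (Matrix.charpoly_monic _).ne_zero),
    Polynomial.roots_mul (mul_ne_zero (pow_ne_zero _ X_ne_zero) hs),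
    Polynomial.roots_multiset_prod_X_sub_C, Polynomial.roots_X_pow, Polynomial.roots_X_pow] at hroots
  simpa [randicEnergy_eq_sum_roots, Multiset.map_nsmul, Multiset.sum_nsmul] using hroots

lemma randicEnergy_caterpillar_three {a b c : ℕ} (ha : 1 ≤ a) :
    randicEnergy (caterpillar 3 ![a, b, c]) = 2 + 2 * √(
      (2 - 2 / ((b : ℝ) + 2)
          - (1 / ((a : ℝ) + 1) + 1 / ((c : ℝ) + 1)) * (1 - 1 / ((b : ℝ) + 2)))
        + 2 * √(b / ((b : ℝ) + 2) * (a / ((a : ℝ) + 1)) * (c / ((c : ℝ) + 1)))) := by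
  have hP : (0 : ℝ) ≤ b / ((b : ℝ) + 2) * (a / ((a : ℝ) + 1)) * (c / ((c : ℝ) + 1)) := by
    positivity
  have hchar := fun (t : ℝ) (ht : t ≠ 0) => eval_charpoly_caterpillar_three ![a, b, c] ht
  simp only [Matrix.cons_val] at hchar
  have hdisc : 4 * (b / ((b : ℝ) + 2) * (a / ((a : ℝ) + 1)) * (c / ((c : ℝ) + 1))) ≤
      (2 - 2 / ((b : ℝ) + 2)
        - (1 / ((a : ℝ) + 1) + 1 / ((c : ℝ) + 1)) * (1 - 1 / ((b : ℝ) + 2))) ^ 2 := by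
    have hx : (a : ℝ) / (a + 1) = 1 - 1 / (a + 1) := by field_simp; ring
    have hy : (b : ℝ) / (b + 2) = 1 - 2 * (1 / (b + 2)) := by field_simp; ring
    have hz : (c : ℝ) / (c + 1) = 1 - 1 / (c + 1) := by field_simp; ring
    have hy' : 0 ≤ 1 - 2 * (1 / ((b : ℝ) + 2)) := hy ▸ by positivity
    rw [hx, hy, hz, show (2 : ℝ) / (b + 2) = 2 * (1 / (b + 2)) by ring]
    generalize 1 / ((a : ℝ) + 1) = x at *
    generalize 1 / ((b : ℝ) + 2) = y at *
    generalize 1 / ((c : ℝ) + 1) = z at *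
    nlinarith [mul_nonneg hy' (sq_nonneg (x - z)), sq_nonneg (y * (x + z - 2))]
  have hS0 : 0 ≤ 2 - 2 / ((b : ℝ) + 2)
        - (1 / ((a : ℝ) + 1) + 1 / ((c : ℝ) + 1)) * (1 - 1 / ((b : ℝ) + 2)) := by
    have hx : 1 / ((a : ℝ) + 1) ≤ 1 := by rw [div_le_one (by positivity)]; simp
    have hz : 1 / ((c : ℝ) + 1) ≤ 1 := by rw [div_le_one (by positivity)]; simp
    have hy : 1 / ((b : ℝ) + 2) ≤ 1 := by
      rw [div_le_one (by positivity)]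
      linarith [(b.cast_nonneg : (0 : ℝ) ≤ b)]
    rw [show (2 : ℝ) / (b + 2) = 2 * (1 / (b + 2)) by ring]
    nlinarith
  generalize (b : ℝ) / (b + 2) * (a / ((a : ℝ) + 1)) * (c / ((c : ℝ) + 1)) = P at *
  generalize 2 - 2 / ((b : ℝ) + 2)
        - (1 / ((a : ℝ) + 1) + 1 / ((c : ℝ) + 1)) * (1 - 1 / ((b : ℝ) + 2)) = S at *
  obtain ⟨Q, hQ, rfl⟩ : ∃ Q : ℝ, 0 ≤ Q ∧ P = Q ^ 2 :=
    ⟨√P, Real.sqrt_nonneg P, (Real.sq_sqrt hP).symm⟩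
  have hS : 2 * Q ≤ S := by
    refine (pow_le_pow_iff_left₀ (by linarith) hS0 two_ne_zero).1 ?_
    linarith [mul_pow 2 Q 2]
  rw [Real.sqrt_sq hQ, randicEnergy_eq_of_eval_charpoly _ three_ne_zero
    (m := ∑ i, ![a, b, c] i) (by simp [Fin.sum_univ_three]; omega)
    {1, -1, (√(S + 2 * Q) + √(S - 2 * Q)) / 2, (√(S + 2 * Q) - √(S - 2 * Q)) / 2,
      -((√(S + 2 * Q) + √(S - 2 * Q)) / 2), -((√(S + 2 * Q) - √(S - 2 * Q)) / 2)}]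
  · simp only [Multiset.insert_eq_cons, Multiset.map_cons, Multiset.map_singleton,
      Multiset.sum_cons, Multiset.sum_singleton]
    rw [← sum_abs_four_roots hQ, abs_neg 1, abs_one]
    ring
  · intro t ht
    rw [hchar t ht, ← four_roots_factorization hQ hS t]
    simp only [Multiset.insert_eq_cons, Multiset.map_cons, Multiset.map_singleton,
      Multiset.prod_cons, Multiset.prod_singleton]
    ring

/-- For a fixed number of pendant vertices at the two ends of the spine, the Randić energy
increases with the product of the numbers of pendant vertices at the two ends. -/
lemma randicEnergy_caterpillar_three_le {a b c a' c' : ℕ} (ha : 1 ≤ a) (ha' : 1 ≤ a')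
    (hsum : a + c = a' + c') (hmul : a * c ≤ a' * c') :
    randicEnergy (caterpillar 3 ![a, b, c]) ≤ randicEnergy (caterpillar 3 ![a', b, c']) := by
  rw [randicEnergy_caterpillar_three ha, randicEnergy_caterpillar_three ha']
  have hsumR : (a : ℝ) + c = a' + c' := by exact_mod_cast hsum
  have hmulR : (a : ℝ) * c ≤ a' * c' := by exact_mod_cast hmul
  have hinv : 1 / ((a' : ℝ) + 1) + 1 / ((c' : ℝ) + 1) ≤ 1 / ((a : ℝ) + 1) + 1 / ((c : ℝ) + 1) := by
    rw [div_add_div _ _ (by positivity) (by positivity),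
      div_add_div _ _ (by positivity) (by positivity)]
    refine div_le_div₀ (by positivity) ?_ (by positivity) ?_ <;> nlinarith
  have hprod : (a : ℝ) / (a + 1) * (c / (c + 1)) ≤ a' / (a' + 1) * (c' / (c' + 1)) := by
    have key : ∀ x y : ℕ, (x : ℝ) / (x + 1) * (y / (y + 1)) =
        1 - ((x : ℝ) + y + 1) / (x * y + (x + y + 1)) := by
      intro x y
      have : (x : ℝ) * y + (x + y + 1) ≠ 0 := by positivity
      field_simp
      ring
    rw [key, key, hsumR]
    gcongr
  have hb : 0 ≤ 1 - 1 / ((b : ℝ) + 2) := by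
    rw [sub_nonneg, div_le_one (by positivity)]
    linarith [(b.cast_nonneg : (0 : ℝ) ≤ b)]
  simp only [mul_assoc]
  gcongr

/-- Let `n ≥ 7`, let `b ∈ {1, …, n-6}` be fixed, and for
`p = 1, …, n-b-4` let `T_p = T(p, b, n-p-b-3)` be the caterpillar of order `n`.  Then for every
such `p`, `RE(T_1) ≤ RE(T_p) ≤ RE(T_{⌊(n-b-3)/2⌋})`. -/
theorem caterpillar3_extremal_middle_fixed (n b : ℕ) (hn : 7 ≤ n) (hb1 : 1 ≤ b)
    (hb2 : b ≤ n - 6) :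
    ∀ p : ℕ, 1 ≤ p → p ≤ n - b - 4 →
      randicEnergy (caterpillar 3 ![1, b, n - 1 - b - 3])
          ≤ randicEnergy (caterpillar 3 ![p, b, n - p - b - 3]) ∧
      randicEnergy (caterpillar 3 ![p, b, n - p - b - 3])
          ≤ randicEnergy
              (caterpillar 3 ![(n - b - 3) / 2, b, n - (n - b - 3) / 2 - b - 3]) := by
  intro p hp1 hp2
  obtain ⟨c, hc⟩ : ∃ c, n - p - b - 3 = c + 1 := ⟨n - p - b - 4, by omega⟩
  constructor
  · refine randicEnergy_caterpillar_three_le le_rfl hp1 (by omega) ?_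
    rw [hc, show n - 1 - b - 3 = p + c by omega]
    nlinarith [Nat.mul_le_mul_right c hp1]
  · refine randicEnergy_caterpillar_three_le hp1 (by omega) (by omega) ?_
    obtain ⟨h, hh⟩ : ∃ h, (n - b - 3) / 2 = h := ⟨_, rfl⟩
    obtain ⟨k, hk⟩ : ∃ k, n - h - b - 3 = k := ⟨_, rfl⟩
    rw [hh, hk, hc]
    have hsum : p + (c + 1) = h + k := by omega
    have hk' : k = h ∨ k = h + 1 := by omega
    rcases hk' with rfl | rfl
    · zify at hsum ⊢
      nlinarith [sq_nonneg ((p : ℤ) - (c + 1))]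
    · zify at hsum ⊢
      rcases le_or_gt p h with hle | hlt
      · zify at hle
        nlinarith [mul_nonneg (sub_nonneg.2 hle) (sub_nonneg.2 hle)]
      · have : (h : ℤ) + 1 ≤ p := by exact_mod_cast hlt
        nlinarith [mul_nonneg (sub_nonneg.2 this) (sub_nonneg.2 this)]
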